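/- Let J be an instance in which every job has unit processing time p_j = 1, and let μ : ℕ → ℕ be any function. If there exists a schedule of J assigning to each job j a slot t_j with r_j ≤ t_j < d_j such that for every t the number of jobs with t_j = t is at most μ(t), then the time-varying EDF schedule — which at each integer time t processes, among the released and unfinished jobs, the min(μ(t), number of such jobs) jobs with the smallest deadlines (ties broken by earlier release date and then lower index) — also completes every job by its deadline. -/

import Mathlib

/-- A job with release date `r`, deadline `d`, and processing time `p`. -/
structure Job where
  r : ℕ
  d : ℕ
  p : ℕ

/-- A job is valid if `1 ≤ p` and `p ≤ d - r` (i.e. `r + p ≤ d`). -/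
def Job.valid (j : Job) : Prop := 1 ≤ j.p ∧ j.r + j.p ≤ j.d

/-- The laxity `ℓ_j = d_j - r_j - p_j` of a job. -/
def Job.lax (j : Job) : ℕ := j.d - j.r - j.p

/-- A preemptive schedule of the instance `J` is feasible on `m` machines if at most `m`
jobs are processed in every slot, every job is only processed inside its window, and
every job is processed for exactly `p_j` slots. -/
def FeasiblePre {n : ℕ} (J : Fin n → Job) (m : ℕ) : Prop :=
  ∃ S : ℕ → Finset (Fin n),
    (∀ t, (S t).card ≤ m) ∧
    (∀ t j, j ∈ S t → (J j).r ≤ t ∧ t < (J j).d) ∧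
    (∀ j, ((Finset.range (J j).d).filter (fun t => j ∈ S t)).card = (J j).p)

/-- The minimum number of machines on which `J` admits a feasible preemptive schedule. -/
noncomputable def mOpt {n : ℕ} (J : Fin n → Job) : ℕ := sInf {m | FeasiblePre J m}

/-- From the set `A`, select the (at most) `m'` smallest elements w.r.t. the
(irreflexive, total) order `lt`. -/
def select {n : ℕ} (m' : ℕ) (lt : Fin n → Fin n → Prop) [DecidableRel lt]
    (A : Finset (Fin n)) : Finset (Fin n) :=
  A.filter (fun j => (A.filter fun k => lt k j).card < m')

/-- EDF priority: smaller deadline first, ties broken by earlier release date,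
then by lower index. -/
def edfLt {n : ℕ} (J : Fin n → Job) (a b : Fin n) : Prop :=
  (J a).d < (J b).d ∨
    ((J a).d = (J b).d ∧
      ((J a).r < (J b).r ∨ ((J a).r = (J b).r ∧ a < b)))

instance {n : ℕ} (J : Fin n → Job) : DecidableRel (edfLt J) := fun a b => by
  unfold edfLt; infer_instance

/-- The set of active jobs at time `t`: released and not yet finished, given that job
`j` has been processed for `c j` slots so far. -/
def activeSet {n : ℕ} (J : Fin n → Job) (c : Fin n → ℕ) (t : ℕ) : Finset (Fin n) :=
  Finset.univ.filter (fun j => (J j).r ≤ t ∧ c j < (J j).p)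

/-- `edfCntVar J μ t j` is the number of slots before time `t` in which the
time-varying EDF schedule with machine capacity `μ` processes job `j`. -/
def edfCntVar {n : ℕ} (J : Fin n → Job) (μ : ℕ → ℕ) : ℕ → Fin n → ℕ
  | 0 => fun _ => 0
  | t + 1 => fun j =>
      edfCntVar J μ t j +
        (if j ∈ select (μ t) (edfLt J) (activeSet J (edfCntVar J μ t) t)
          then 1 else 0)

/-- The set of jobs processed in slot `t` by the time-varying EDF schedule, which at
time `t` processes the `min(μ(t), #active)` released unfinished jobs of smallest
deadline (ties by release date, then index). -/
def edfSchedVar {n : ℕ} (J : Fin n → Job) (μ : ℕ → ℕ) (t : ℕ) : Finset (Fin n) :=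
  select (μ t) (edfLt J) (activeSet J (edfCntVar J μ t) t)

theorem edfLt_irrefl {n : ℕ} (J : Fin n → Job) (a : Fin n) : ¬ edfLt J a a := by
  simp [edfLt]

theorem edfLt_trans {n : ℕ} (J : Fin n → Job) {a b c : Fin n}
    (hab : edfLt J a b) (hbc : edfLt J b c) : edfLt J a c := by
  unfold edfLt at *
  omega

theorem edfLt_deadline_le {n : ℕ} (J : Fin n → Job) {a b : Fin n}
    (hab : edfLt J a b) : (J a).d ≤ (J b).d := by
  unfold edfLt at hab
  omega

/-- If some element of a downward closed class `P` is passed over by `select`, then `select`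
picks at least `m` elements of `P`. -/
theorem le_card_filter_select {n : ℕ} (m : ℕ) (lt : Fin n → Fin n → Prop) [DecidableRel lt]
    (hirrefl : ∀ a, ¬ lt a a) (htrans : ∀ a b c, lt a b → lt b c → lt a c)
    (A : Finset (Fin n)) (P : Fin n → Prop) [DecidablePred P]
    (hP : ∀ a b, lt a b → P b → P a)
    {k : Fin n} (hkA : k ∈ A) (hkP : P k) (hk : k ∉ select m lt A) :
    m ≤ ((select m lt A).filter P).card := by
  obtain ⟨x, hx, hmin⟩ := Finset.exists_min_image
    (A.filter fun a => P a ∧ a ∉ select m lt A) (fun a => (A.filter fun b => lt b a).card)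
    ⟨k, by simp [hkA, hkP, hk]⟩
  obtain ⟨hxA, hxP, hxs⟩ := Finset.mem_filter.1 hx
  have hm : m ≤ (A.filter fun b => lt b x).card := by
    by_contra! h
    exact hxs (Finset.mem_filter.2 ⟨hxA, h⟩)
  refine hm.trans (Finset.card_le_card fun y hy => ?_)
  obtain ⟨hyA, hyx⟩ := Finset.mem_filter.1 hy
  refine Finset.mem_filter.2 ⟨?_, hP y x hyx hxP⟩
  by_contra hys
  have hsub : (A.filter fun b => lt b y) ⊆ A.filter fun b => lt b x := fun z hz =>
    Finset.mem_filter.2 ⟨(Finset.mem_filter.1 hz).1,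
      htrans z y x (Finset.mem_filter.1 hz).2 hyx⟩
  have hlt := Finset.card_lt_card ((Finset.ssubset_iff_of_subset hsub).2
    ⟨y, hy, fun h => hirrefl y (Finset.mem_filter.1 h).2⟩)
  exact (hmin y (Finset.mem_filter.2 ⟨hyA, hP y x hyx hxP, hys⟩)).not_gt hlt

theorem mem_edfSchedVar_active {n : ℕ} {J : Fin n → Job} {μ : ℕ → ℕ} {t : ℕ} {j : Fin n}
    (h : j ∈ edfSchedVar J μ t) : (J j).r ≤ t ∧ edfCntVar J μ t j < (J j).p := by
  simpa [activeSet] using (Finset.mem_filter.1 h).1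

theorem edfCntVar_succ {n : ℕ} (J : Fin n → Job) (μ : ℕ → ℕ) (t : ℕ) (j : Fin n) :
    edfCntVar J μ (t + 1) j
      = edfCntVar J μ t j + if j ∈ edfSchedVar J μ t then 1 else 0 := rfl

theorem exists_mem_edfSchedVar_of_edfCntVar_ne_zero {n : ℕ} {J : Fin n → Job} {μ : ℕ → ℕ}
    {t : ℕ} {j : Fin n} (h : edfCntVar J μ t j ≠ 0) : ∃ s < t, j ∈ edfSchedVar J μ s := by
  induction t with
  | zero => exact absurd rfl h
  | succ t ih =>
    by_cases hj : j ∈ edfSchedVar J μ t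
    · exact ⟨t, t.lt_succ_self, hj⟩
    · rw [edfCntVar_succ, if_neg hj] at h
      obtain ⟨s, hs, hjs⟩ := ih h
      exact ⟨s, hs.trans t.lt_succ_self, hjs⟩

/-- The jobs whose window lies inside `[a, D)` fit into the capacity of that interval. -/
theorem card_windows_le_sum_capacity {n : ℕ} (J : Fin n → Job) (μ : ℕ → ℕ) {tj : Fin n → ℕ}
    (hwin : ∀ j, (J j).r ≤ tj j ∧ tj j < (J j).d)
    (hcap : ∀ t, (Finset.univ.filter (fun j => tj j = t)).card ≤ μ t) (a D : ℕ) :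
    (Finset.univ.filter fun j => a ≤ (J j).r ∧ (J j).d ≤ D).card
      ≤ ∑ t ∈ Finset.Ico a D, μ t := by
  rw [Finset.card_eq_sum_card_fiberwise (f := tj) (t := Finset.Ico a D)]
  · refine Finset.sum_le_sum fun t _ => (Finset.card_le_card ?_).trans (hcap t)
    exact Finset.filter_subset_filter _ (Finset.filter_subset _ _)
  · intro j hj
    have hj' : a ≤ (J j).r ∧ (J j).d ≤ D := by simpa using hj
    have := hwin j
    simp only [Finset.coe_Ico, Set.mem_Ico]
    omega

/-- At every time `t ≤ D`, the jobs due by `D` that EDF has not yet processed fit into the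
remaining capacity of `[t, D)`. -/
theorem card_unfinished_le_sum_capacity {n : ℕ} (J : Fin n → Job) (hp : ∀ j, (J j).p = 1)
    (μ : ℕ → ℕ) {tj : Fin n → ℕ}
    (hwin : ∀ j, (J j).r ≤ tj j ∧ tj j < (J j).d)
    (hcap : ∀ t, (Finset.univ.filter (fun j => tj j = t)).card ≤ μ t) (D t : ℕ) (ht : t ≤ D) :
    (Finset.univ.filter fun j => (J j).d ≤ D ∧ edfCntVar J μ t j = 0).card
      ≤ ∑ s ∈ Finset.Ico t D, μ s := by
  induction t with
  | zero => simpa [edfCntVar] using card_windows_le_sum_capacity J μ hwin hcap 0 D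
  | succ t ih =>
    by_cases hall : ∀ k ∈ activeSet J (edfCntVar J μ t) t, (J k).d ≤ D → k ∈ edfSchedVar J μ t
    · refine (Finset.card_le_card fun j hj => ?_).trans
        (card_windows_le_sum_capacity J μ hwin hcap (t + 1) D)
      simp only [Finset.mem_filter, Finset.mem_univ, true_and, edfCntVar_succ,
        Nat.add_eq_zero_iff] at hj ⊢
      obtain ⟨hd, h0, hs⟩ := hj
      refine ⟨?_, hd⟩
      by_contra! hr
      have := hall j (by simp [activeSet, hp, h0]; omega) hd
      simp [this] at hs
    · push Not at hall
      obtain ⟨k, hkA, hkD, hk⟩ := hall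
      have hsel : μ t ≤ ((edfSchedVar J μ t).filter fun j => (J j).d ≤ D).card :=
        le_card_filter_select (μ t) (edfLt J) (edfLt_irrefl J) (fun _ _ _ => edfLt_trans J)
          _ (fun j => (J j).d ≤ D) (fun _ _ hab hb => (edfLt_deadline_le J hab).trans hb)
          hkA hkD hk
      have hdisj : Disjoint
          (Finset.univ.filter fun j => (J j).d ≤ D ∧ edfCntVar J μ (t + 1) j = 0)
          ((edfSchedVar J μ t).filter fun j => (J j).d ≤ D) := by
        refine Finset.disjoint_left.2 fun j hj hj' => ?_
        simp only [Finset.mem_filter, edfCntVar_succ] at hj hj'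
        simp [hj'.1] at hj
      have hsub : (Finset.univ.filter fun j => (J j).d ≤ D ∧ edfCntVar J μ (t + 1) j = 0) ∪
          ((edfSchedVar J μ t).filter fun j => (J j).d ≤ D) ⊆
          Finset.univ.filter fun j => (J j).d ≤ D ∧ edfCntVar J μ t j = 0 := by
        intro j hj
        simp only [Finset.mem_union, Finset.mem_filter, Finset.mem_univ, true_and,
          edfCntVar_succ, Nat.add_eq_zero_iff] at hj ⊢
        rcases hj with ⟨hd, h0, -⟩ | ⟨hs, hd⟩
        · exact ⟨hd, h0⟩
        · have := (mem_edfSchedVar_active hs).2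
          rw [hp] at this
          exact ⟨hd, by omega⟩
      have hcard := Finset.card_le_card hsub
      rw [Finset.card_union_of_disjoint hdisj] at hcard
      have hsum := Finset.sum_eq_sum_Ico_succ_bot (show t < D by omega) μ
      have := ih (by omega)
      omega

/-- Let every job of `J` have unit processing time and let
`μ : ℕ → ℕ` be any machine-capacity function. If some schedule assigns to each job `j`
a slot `t_j` with `r_j ≤ t_j < d_j` such that at most `μ(t)` jobs are assigned to each
slot `t`, then the time-varying EDF schedule with capacity `μ` also completes every
job by its deadline. -/
theorem edfVar_unit_optimal {n : ℕ} (J : Fin n → Job)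
    (hval : ∀ j, (J j).valid)
    (hp : ∀ j, (J j).p = 1) (μ : ℕ → ℕ)
    (hfeas : ∃ tj : Fin n → ℕ,
      (∀ j, (J j).r ≤ tj j ∧ tj j < (J j).d) ∧
      (∀ t, (Finset.univ.filter (fun j => tj j = t)).card ≤ μ t)) :
    ∀ j, ∃ t, (J j).r ≤ t ∧ t < (J j).d ∧ j ∈ edfSchedVar J μ t := by
  obtain ⟨tj, hwin, hcap⟩ := hfeas
  intro j
  have hcard := card_unfinished_le_sum_capacity J hp μ hwin hcap (J j).d (J j).d le_rfl
  rw [Finset.Ico_self, Finset.sum_empty, Nat.le_zero, Finset.card_eq_zero] at hcard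
  have hne : edfCntVar J μ (J j).d j ≠ 0 := fun h0 =>
    (Finset.eq_empty_iff_forall_notMem.1 hcard j) (by simp [h0])
  obtain ⟨t, ht, hjt⟩ := exists_mem_edfSchedVar_of_edfCntVar_ne_zero hne
  exact ⟨t, (mem_edfSchedVar_active hjt).1, ht, hjt⟩
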